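/- Let k > 1 and let λ₁, λ₂, λ₃, λ₄ be non-zero real numbers, not all of the same sign, and let ω be a real number. There exist δ with 0 < δ < 1, a constant C > 0 and X₀ such that for all X ≥ X₀ and all η with 0 < η ≤ 1, the integral ∫_ℝ T_2(λ₁α) T_2(λ₂α) T_2(λ₃α) T_k(λ₄α) K_η(α) e(−ωα) dα is real and at least C η² X^{1/2 + 1/k}. -/

import Mathlib

open scoped Classical
open MeasureTheory

noncomputable section

/-- `e x = exp(2πix)` -/
def e (x : ℝ) : ℂ := Complex.exp (2 * Real.pi * Complex.I * x)

/-- The exponential sum `S_k(α)` over primes `p` with `δX ≤ p^k ≤ X`. -/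
def S (k δ X α : ℝ) : ℂ :=
  ∑ p ∈ (Finset.range (⌈X⌉₊ + 1)).filter
      (fun p : ℕ => p.Prime ∧ δ * X ≤ (p : ℝ) ^ k ∧ (p : ℝ) ^ k ≤ X),
    (Real.log p : ℂ) * e ((p : ℝ) ^ k * α)

/-- The exponential sum `U_k(α)` over naturals `n` with `δX ≤ n^k ≤ X`. -/
def U (k δ X α : ℝ) : ℂ :=
  ∑ n ∈ (Finset.range (⌈X⌉₊ + 1)).filter
      (fun n : ℕ => δ * X ≤ (n : ℝ) ^ k ∧ (n : ℝ) ^ k ≤ X),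
    e ((n : ℝ) ^ k * α)

/-- The exponential integral `T_k(α)`. -/
def T (k δ X α : ℝ) : ℂ :=
  ∫ t in (δ * X) ^ (1 / k)..(X ^ (1 / k)), e (α * t ^ k)

/-- Chebyshev theta function. -/
def theta (x : ℝ) : ℝ :=
  ∑ p ∈ (Finset.range (⌊x⌋₊ + 1)).filter Nat.Prime, Real.log p

/-- The generalized Selberg integral `𝒥_k(X,h)`. -/
def selbergJ (k X h : ℝ) : ℝ :=
  ∫ x in X..(2 * X),
    (theta ((x + h) ^ (1 / k)) - theta (x ^ (1 / k)) -
      ((x + h) ^ (1 / k) - x ^ (1 / k))) ^ 2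

/-- `ψ(m,z) = 1` iff every prime factor of `m` is at least `z`. -/
def psi (m : ℕ) (z : ℝ) : ℝ :=
  if ∀ p : ℕ, p.Prime → p ∣ m → z ≤ (p : ℝ) then 1 else 0

/-- The function `z(p)` of Harman–Kumchev. -/
def zfun (X : ℝ) (p : ℕ) : ℝ :=
  if (p : ℝ) < X ^ ((1 : ℝ) / 7) then X ^ ((5 : ℝ) / 28) * (p : ℝ) ^ (-(1 : ℝ) / 2)
  else if (p : ℝ) ≤ X ^ ((3 : ℝ) / 14) then (p : ℝ)
  else X ^ ((5 : ℝ) / 14) * (p : ℝ)⁻¹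

/-- The Harman–Kumchev sieve weight `ρ(m)`. -/
def rho (X : ℝ) (m : ℕ) : ℝ :=
  psi m (X ^ ((5 : ℝ) / 42)) -
    ∑ p ∈ (Finset.range (⌈X ^ ((1 : ℝ) / 4)⌉₊ + 1)).filter
        (fun p : ℕ => p.Prime ∧ X ^ ((5 : ℝ) / 42) ≤ (p : ℝ) ∧ (p : ℝ) < X ^ ((1 : ℝ) / 4) ∧ p ∣ m),
      psi (m / p) (zfun X p)

/-- The sieved exponential sum `S̃_2(α)`. -/
def Stilde (δ X α : ℝ) : ℂ :=
  ∑ m ∈ (Finset.range (⌈X⌉₊ + 1)).filter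
      (fun m : ℕ => δ * X ≤ (m : ℝ) ^ 2 ∧ (m : ℝ) ^ 2 ≤ X),
    (rho X m : ℂ) * e ((m : ℝ) ^ 2 * α)

/-- The Fejér-type kernel `K_η(α)`. -/
def Kf (η α : ℝ) : ℝ :=
  if α = 0 then η ^ 2 else (Real.sin (Real.pi * α * η) / (Real.pi * α)) ^ 2


open scoped FourierTransform

lemma continuous_e : Continuous e := by
  unfold e
  fun_prop

lemma norm_e (x : ℝ) : ‖e x‖ = 1 := by
  have : e x = Complex.exp (((2 * Real.pi * x : ℝ) : ℂ) * Complex.I) := by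
    unfold e
    push_cast
    ring_nf
  rw [this, Complex.norm_exp_ofReal_mul_I]

lemma e_add (x y : ℝ) : e (x + y) = e x * e y := by
  unfold e
  rw [← Complex.exp_add]
  push_cast
  ring_nf

/-- The triangle function of half-width `η`, whose Fourier transform is `Kf η`. -/
def triangle (η x : ℝ) : ℝ := max 0 (η - |x|)

lemma continuous_triangle (η : ℝ) : Continuous (triangle η) := by
  unfold triangle
  fun_prop

lemma triangle_nonneg (η x : ℝ) : 0 ≤ triangle η x := le_max_left _ _

lemma triangle_le {η : ℝ} (hη : 0 ≤ η) (x : ℝ) : triangle η x ≤ η :=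
  max_le hη (by linarith [abs_nonneg x])

lemma half_le_triangle {η x : ℝ} (hx : |x| ≤ η / 2) : η / 2 ≤ triangle η x :=
  le_max_of_le_right (by linarith)

lemma triangle_eq_zero_of_notMem {η x : ℝ} (hx : x ∉ Set.Ioc (-η) η) : triangle η x = 0 := by
  apply max_eq_left
  by_contra! h
  have := abs_lt.1 (by linarith : |x| < η)
  exact hx ⟨this.1, this.2.le⟩

lemma integrable_triangle {η : ℝ} : Integrable (triangle η) := by
  have h : IntegrableOn (triangle η) (Set.Ioc (-η) η) :=
    ((continuous_triangle η).continuousOn.integrableOn_Icc).mono_set Set.Ioc_subset_Icc_self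
  exact h.integrable_of_forall_notMem_eq_zero fun x hx => triangle_eq_zero_of_notMem hx

lemma integral_triangle_mul_cexp {η : ℝ} (hη : 0 < η) {c : ℂ} (hc : c ≠ 0) :
    ∫ x : ℝ, Complex.exp (c * x) * (triangle η x : ℂ) =
      (Complex.exp (c * η) + Complex.exp (-(c * η)) - 2) / c ^ 2 := by
  have hcont : Continuous fun x : ℝ => Complex.exp (c * x) * (triangle η x : ℂ) := by
    have := continuous_triangle η
    fun_prop
  have hexp (x : ℝ) : HasDerivAt (fun y : ℝ => Complex.exp (c * y)) (Complex.exp (c * x) * c) x := by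
    have h := ((hasDerivAt_id x).ofReal_comp.const_mul c).cexp
    simpa using h
  have hid (x : ℝ) : HasDerivAt (fun y : ℝ => (y : ℂ)) 1 x := by
    simpa using (hasDerivAt_id x).ofReal_comp
  have hleft : ∫ x in (-η)..0, Complex.exp (c * x) * (triangle η x : ℂ) =
      (η / c - 1 / c ^ 2) + Complex.exp (-(c * η)) / c ^ 2 := by
    rw [intervalIntegral.integral_eq_sub_of_hasDerivAt
      (f := fun x : ℝ => ((η + x) / c - 1 / c ^ 2) * Complex.exp (c * x)) _
      (hcont.intervalIntegrable _ _)]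
    · push_cast
      simp
      ring
    · intro x hx
      rw [Set.uIcc_of_le (by linarith)] at hx
      have ht : triangle η x = η + x := by
        rw [triangle, abs_of_nonpos hx.2, max_eq_right (by linarith [hx.1])]
        ring
      rw [ht]
      refine ((((hid x).const_add (η : ℂ)).div_const c |>.sub_const (1 / c ^ 2)).mul
        (hexp x)).congr_deriv ?_
      push_cast
      field_simp
      ring
  have hright : ∫ x in (0 : ℝ)..η, Complex.exp (c * x) * (triangle η x : ℂ) =
      Complex.exp (c * η) / c ^ 2 - (η / c + 1 / c ^ 2) := by
    rw [intervalIntegral.integral_eq_sub_of_hasDerivAt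
      (f := fun x : ℝ => ((η - x) / c + 1 / c ^ 2) * Complex.exp (c * x)) _
      (hcont.intervalIntegrable _ _)]
    · simp
      ring
    · intro x hx
      rw [Set.uIcc_of_le hη.le] at hx
      have ht : triangle η x = η - x := by
        rw [triangle, abs_of_nonneg hx.1, max_eq_right (by linarith [hx.2])]
      rw [ht]
      refine ((((hid x).const_sub (η : ℂ)).div_const c |>.add_const (1 / c ^ 2)).mul
        (hexp x)).congr_deriv ?_
      push_cast
      field_simp
      ring
  rw [← setIntegral_eq_integral_of_forall_compl_eq_zero (s := Set.Ioc (-η) η),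
    ← intervalIntegral.integral_of_le (by linarith),
    ← intervalIntegral.integral_add_adjacent_intervals (b := 0)
      (hcont.intervalIntegrable _ _) (hcont.intervalIntegrable _ _), hleft, hright]
  · field_simp
    ring
  · intro x hx
    rw [triangle_eq_zero_of_notMem hx]
    simp

lemma fourier_triangle {η : ℝ} (hη : 0 < η) {w : ℝ} (hw : w ≠ 0) :
    𝓕 (fun x => (triangle η x : ℂ)) w = (Kf η w : ℂ) := by
  have hπ : (Real.pi : ℂ) ≠ 0 := by exact_mod_cast Real.pi_ne_zero
  have hw' : (w : ℂ) ≠ 0 := by exact_mod_cast hw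
  have hc : -(2 * Real.pi * w * Complex.I) ≠ 0 := by simp [hπ, hw']
  rw [Real.fourier_real_eq_integral_exp_smul]
  have h := integral_triangle_mul_cexp hη hc
  have hcos : Complex.exp (-(2 * Real.pi * w * Complex.I) * η) +
      Complex.exp (-(-(2 * Real.pi * w * Complex.I) * η)) - 2 =
      -4 * Complex.sin (Real.pi * w * η) ^ 2 := by
    have h1 := Complex.two_cos (2 * (Real.pi * w * η))
    have h2 := Complex.cos_two_mul (Real.pi * w * η)
    have h3 := Complex.sin_sq_add_cos_sq (Real.pi * w * η)
    rw [show -(2 * Real.pi * w * Complex.I) * η = -(2 * (Real.pi * w * η)) * Complex.I by ring,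
      show -(-(2 * (Real.pi * w * η)) * Complex.I) = 2 * (Real.pi * w * η) * Complex.I by ring]
    linear_combination -h1 + 2 * h2 + 4 * h3
  rw [hcos] at h
  convert h using 1
  · congr 1
    ext x
    rw [smul_eq_mul]
    congr 2
    push_cast
    ring
  · rw [Kf, if_neg hw]
    push_cast
    field_simp
    rw [Complex.I_sq]
    ring

lemma measurable_Kf (η : ℝ) : Measurable (Kf η) := by
  unfold Kf
  exact Measurable.ite (measurableSet_singleton 0) measurable_const (by fun_prop)

lemma integrable_Kf (η : ℝ) : Integrable (Kf η) := by
  refine (integrable_inv_one_add_sq.const_mul (η ^ 2 + 1)).mono'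
    (measurable_Kf η).aestronglyMeasurable ?_
  filter_upwards [compl_mem_ae_iff.2 (measure_singleton (0 : ℝ))] with α hα
  have hα : α ≠ 0 := hα
  rw [Kf, if_neg hα, Real.norm_of_nonneg (sq_nonneg _), ← div_eq_mul_inv, div_pow,
    div_le_div_iff₀ (by positivity) (by positivity)]
  have h1 : Real.sin (Real.pi * α * η) ^ 2 ≤ (Real.pi * α * η) ^ 2 :=
    sq_le_sq.2 Real.abs_sin_le_abs
  have h2 := Real.sin_sq_le_one (Real.pi * α * η)
  have h3 : α ^ 2 ≤ (Real.pi * α) ^ 2 := by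
    nlinarith [Real.pi_gt_three, sq_nonneg α, sq_nonneg (Real.pi - 1)]
  have h4 := mul_le_mul_of_nonneg_right h2 (sq_nonneg α)
  nlinarith

lemma integral_Kf_mul_e {η : ℝ} (hη : 0 < η) (x : ℝ) :
    ∫ α : ℝ, (Kf η α : ℂ) * e (α * x) = (triangle η x : ℂ) := by
  have hae : 𝓕 (fun x => (triangle η x : ℂ)) =ᵐ[volume] fun α => (Kf η α : ℂ) := by
    filter_upwards [compl_mem_ae_iff.2 (measure_singleton (0 : ℝ))] with α hα
    exact fourier_triangle hη hα
  have h := congrFun (Continuous.fourierInv_fourier_eq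
    (f := fun x => (triangle η x : ℂ))
    (Complex.continuous_ofReal.comp (continuous_triangle η)) integrable_triangle.ofReal
    ((integrable_Kf η).ofReal.congr hae.symm)) x
  rw [← h, Real.fourierInv_eq']
  refine integral_congr_ae ?_
  filter_upwards [hae] with α hα
  rw [hα, smul_eq_mul, mul_comm, e]
  congr 2
  simp
  ring

/-- Integrating the characteristic function of the image of `μ` under `φ` against `Kf η`
yields the `μ`-integral of the triangle function of `φ`. -/
lemma integral_integral_e_mul_Kf {Ω : Type*} [MeasurableSpace Ω] (μ : Measure Ω)
    [IsFiniteMeasure μ] {φ : Ω → ℝ} (hφ : Measurable φ) {η : ℝ} (hη : 0 < η) :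
    ∫ α : ℝ, (∫ t, e (α * φ t) ∂μ) * (Kf η α : ℂ) = ((∫ t, triangle η (φ t) ∂μ : ℝ) : ℂ) := by
  have hK := (integrable_Kf η).ofReal (𝕜 := ℂ)
  have hint : Integrable (Function.uncurry fun (α : ℝ) (t : Ω) => e (α * φ t) * (Kf η α : ℂ))
      (volume.prod μ) := by
    refine Integrable.bdd_mul (c := 1) (hK.comp_fst μ)
      (f := fun p : ℝ × Ω => e (p.1 * φ p.2)) ?_ (by simp [norm_e])
    exact (continuous_e.measurable.comp
      (measurable_fst.mul (hφ.comp measurable_snd))).aestronglyMeasurable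
  simp_rw [← integral_mul_const]
  rw [integral_integral_swap hint, ← integral_complex_ofReal]
  simp_rw [← integral_Kf_mul_e hη, mul_comm]

lemma T_eq_setIntegral {k δ X : ℝ} (hk : 0 < k) (hδ : 0 ≤ δ) (hδ1 : δ ≤ 1) (hX : 0 ≤ X) (α : ℝ) :
    T k δ X α = ∫ t in Set.Ioc ((δ * X) ^ (1 / k)) (X ^ (1 / k)), e (α * t ^ k) := by
  rw [T, intervalIntegral.integral_of_le]
  exact Real.rpow_le_rpow (by positivity) (mul_le_of_le_one_left hX hδ1) (by positivity)

lemma mul_measureReal_le_integral {Ω : Type*} [MeasurableSpace Ω] {μ : Measure Ω}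
    [IsFiniteMeasure μ] {f : Ω → ℝ} {s : Set Ω} {c : ℝ} (hs : MeasurableSet s)
    (hf : Integrable f μ) (hf0 : ∀ x, 0 ≤ f x) (hc : ∀ x ∈ s, c ≤ f x) :
    c * μ.real s ≤ ∫ x, f x ∂μ :=
  (setIntegral_ge_of_const_le_real hs (measure_ne_top μ s) hc hf.integrableOn).trans
    (setIntegral_le_integral hf (Filter.Eventually.of_forall hf0))

lemma integrable_triangle_comp {Ω : Type*} [MeasurableSpace Ω] (μ : Measure Ω)
    [IsFiniteMeasure μ] {φ : Ω → ℝ} (hφ : Measurable φ) {η : ℝ} (hη : 0 ≤ η) :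
    Integrable (fun x => triangle η (φ x)) μ := by
  refine Integrable.of_bound ((continuous_triangle η).measurable.comp hφ).aestronglyMeasurable η
    (Filter.Eventually.of_forall fun x => ?_)
  rw [Real.norm_of_nonneg (triangle_nonneg _ _)]
  exact triangle_le hη _

lemma measureReal_restrict_Ioc {a b p q : ℝ} (hap : a ≤ p) (hpq : p ≤ q) (hqb : q ≤ b) :
    (volume.restrict (Set.Ioc a b)).real (Set.Ioc p q) = q - p := by
  rw [measureReal_restrict_apply measurableSet_Ioc,
    Set.inter_eq_left.2 (Set.Ioc_subset_Ioc hap hqb), Real.volume_real_Ioc_of_le hpq]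

/-- Real numbers not all of the same sign satisfy a linear relation with positive coefficients. -/
lemma exists_pos_linear_relation {l1 l2 l3 l4 : ℝ}
    (h1 : l1 ≠ 0) (h2 : l2 ≠ 0) (h3 : l3 ≠ 0) (h4 : l4 ≠ 0)
    (hsign : ¬ ((0 < l1 ∧ 0 < l2 ∧ 0 < l3 ∧ 0 < l4) ∨ (l1 < 0 ∧ l2 < 0 ∧ l3 < 0 ∧ l4 < 0))) :
    ∃ u1 u2 u3 u4 : ℝ, (0 < u1 ∧ u1 ≤ 1 / 2) ∧ (0 < u2 ∧ u2 ≤ 1 / 2) ∧ (0 < u3 ∧ u3 ≤ 1 / 2) ∧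
      (0 < u4 ∧ u4 ≤ 1 / 2) ∧ l1 * u1 + l2 * u2 + l3 * u3 + l4 * u4 = 0 := by
  set P := max l1 0 + max l2 0 + max l3 0 + max l4 0 with hP
  set N := max (-l1) 0 + max (-l2) 0 + max (-l3) 0 + max (-l4) 0 with hN
  have hP0 : 0 < P := by
    by_contra! h
    have a1 := le_max_left l1 0
    have a2 := le_max_left l2 0
    have a3 := le_max_left l3 0
    have a4 := le_max_left l4 0
    have b1 := le_max_right l1 0
    have b2 := le_max_right l2 0
    have b3 := le_max_right l3 0
    have b4 := le_max_right l4 0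
    exact hsign (Or.inr ⟨lt_of_le_of_ne (by linarith) h1, lt_of_le_of_ne (by linarith) h2,
      lt_of_le_of_ne (by linarith) h3, lt_of_le_of_ne (by linarith) h4⟩)
  have hN0 : 0 < N := by
    by_contra! h
    have a1 := le_max_left (-l1) 0
    have a2 := le_max_left (-l2) 0
    have a3 := le_max_left (-l3) 0
    have a4 := le_max_left (-l4) 0
    have b1 := le_max_right (-l1) 0
    have b2 := le_max_right (-l2) 0
    have b3 := le_max_right (-l3) 0
    have b4 := le_max_right (-l4) 0
    exact hsign (Or.inl ⟨lt_of_le_of_ne (by linarith) h1.symm,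
      lt_of_le_of_ne (by linarith) h2.symm, lt_of_le_of_ne (by linarith) h3.symm,
      lt_of_le_of_ne (by linarith) h4.symm⟩)
  have key (l : ℝ) : ∃ u : ℝ, (0 < u ∧ u ≤ 1 / 2) ∧
      l * u = (N * max l 0 - P * max (-l) 0) / (2 * (P + N)) := by
    rcases le_or_gt l 0 with hl | hl
    · refine ⟨P / (2 * (P + N)), ⟨by positivity, ?_⟩, ?_⟩
      · rw [div_le_div_iff₀ (by positivity) (by norm_num)]
        linarith
      · rw [max_eq_right hl, max_eq_left (by linarith)]
        ring
    · refine ⟨N / (2 * (P + N)), ⟨by positivity, ?_⟩, ?_⟩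
      · rw [div_le_div_iff₀ (by positivity) (by norm_num)]
        linarith
      · rw [max_eq_left hl.le, max_eq_right (by linarith)]
        ring
  obtain ⟨u1, hu1, e1⟩ := key l1
  obtain ⟨u2, hu2, e2⟩ := key l2
  obtain ⟨u3, hu3, e3⟩ := key l3
  obtain ⟨u4, hu4, e4⟩ := key l4
  refine ⟨u1, u2, u3, u4, hu1, hu2, hu3, hu4, ?_⟩
  rw [e1, e2, e3, e4]
  have : N * P - P * N = 0 := by ring
  rw [← add_div, ← add_div, ← add_div, div_eq_zero_iff]
  left
  rw [hP, hN] at this ⊢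
  linear_combination this

/-- Solving `l * (t ^ 2 - V) ≪ η` for `t` in a window of length about `η / √X`. -/
lemma le_integral_triangle_quadratic {l δ X η V : ℝ} (hδ : 0 ≤ δ) (hX : 1 ≤ X) (hη : 0 < η)
    (hη1 : η ≤ 1) (hVl : δ * X ≤ V) (hVu : V ≤ 3 / 4 * X) :
    η / 2 * (η / (10 * (1 + |l|)) * X ^ (-(1 / 2) : ℝ)) ≤
      ∫ t in Set.Ioc ((δ * X) ^ (1 / 2 : ℝ)) (X ^ (1 / 2 : ℝ)),
        triangle η (l * (t ^ (2 : ℝ) - V)) := by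
  have hX0 : 0 < X := by linarith
  have hV0 : 0 ≤ V := le_trans (by positivity) hVl
  rw [Real.rpow_neg hX0.le, ← Real.sqrt_eq_rpow, ← Real.sqrt_eq_rpow]
  set d := η / (10 * (1 + |l|)) * (√X)⁻¹ with hd
  have hs1 : 1 ≤ √X := Real.one_le_sqrt.2 hX
  have hd0 : 0 ≤ d := by positivity
  have hdX : d * √X * (10 * (1 + |l|)) = η := by
    rw [hd]
    field_simp
  have hl := abs_nonneg l
  have hdX' : d * √X ≤ η / 10 := by
    nlinarith [mul_nonneg (mul_nonneg hd0 (Real.sqrt_nonneg X)) hl]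
  have hd10 : d ≤ 1 / 10 := by nlinarith
  have hVX : √V ≤ 9 / 10 * √X := by
    rw [Real.sqrt_le_left (by positivity), mul_pow, Real.sq_sqrt hX0.le]
    linarith
  have hVsq := Real.sq_sqrt hV0
  have hbound : ∀ t ∈ Set.Ioc (√V) (√V + d), η / 2 ≤ triangle η (l * (t ^ (2 : ℝ) - V)) := by
    intro t ht
    apply half_le_triangle
    have h0 := Real.sqrt_nonneg V
    have h1 : 0 ≤ t ^ 2 - V := by nlinarith [ht.1]
    have h2 : t ^ 2 - V ≤ 3 * (d * √X) := by nlinarith [ht.1, ht.2]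
    rw [Real.rpow_two, abs_mul, abs_of_nonneg h1]
    nlinarith [mul_le_mul_of_nonneg_left h2 hl, mul_nonneg hd0 (Real.sqrt_nonneg X)]
  have h := mul_measureReal_le_integral
    (μ := volume.restrict (Set.Ioc √(δ * X) √X)) measurableSet_Ioc
    (integrable_triangle_comp _ (by fun_prop) hη.le) (fun _ => triangle_nonneg _ _) hbound
  rwa [measureReal_restrict_Ioc (Real.sqrt_le_sqrt hVl) (by linarith) (by linarith),
    add_sub_cancel_left] at h

lemma rpow_mem_of_mem_Ioc {k u v X t : ℝ} (hk : 0 < k) (hu : 0 ≤ u) (hv : 0 ≤ v) (hX : 0 ≤ X)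
    (ht : t ∈ Set.Ioc ((u * X) ^ (1 / k)) ((v * X) ^ (1 / k))) :
    u * X ≤ t ^ k ∧ t ^ k ≤ v * X := by
  have h0 : 0 ≤ (u * X) ^ (1 / k) := by positivity
  have h (w : ℝ) (hw : 0 ≤ w) : ((w * X) ^ (1 / k)) ^ k = w * X := by
    rw [one_div, Real.rpow_inv_rpow (by positivity) hk.ne']
  constructor
  · rw [← h u hu]
    exact Real.rpow_le_rpow h0 ht.1.le hk.le
  · rw [← h v hv]
    exact Real.rpow_le_rpow (h0.trans ht.1.le) ht.2 hk.le

lemma measureReal_restrict_Ioc_rpow {k δ u v X : ℝ} (hk : 0 < k) (hδ : 0 ≤ δ) (hu : δ ≤ u)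
    (huv : u ≤ v) (hv : v ≤ 1) (hX : 0 ≤ X) :
    (volume.restrict (Set.Ioc ((δ * X) ^ (1 / k)) (X ^ (1 / k)))).real
      (Set.Ioc ((u * X) ^ (1 / k)) ((v * X) ^ (1 / k))) =
      (v ^ (1 / k) - u ^ (1 / k)) * X ^ (1 / k) := by
  have hk' : 0 ≤ 1 / k := by positivity
  have hu0 := hδ.trans hu
  have hv0 := hu0.trans huv
  rw [measureReal_restrict_Ioc
    (Real.rpow_le_rpow (by positivity) (by gcongr) hk')
    (Real.rpow_le_rpow (by positivity) (by gcongr) hk')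
    (Real.rpow_le_rpow (by positivity) (mul_le_of_le_one_left hX hv) hk'),
    Real.mul_rpow hu0 hX, Real.mul_rpow hv0 hX]
  ring

/-- The integral of the product of the four `T`'s as an integral over a box. -/
lemma integral_T_mul_eq {k δ X η : ℝ} (hk : 0 < k) (hδ : 0 ≤ δ) (hδ1 : δ ≤ 1) (hX : 0 ≤ X)
    (hη : 0 < η) (l1 l2 l3 l4 ω : ℝ) (μ ν : Measure ℝ)
    (hμ : μ = volume.restrict (Set.Ioc ((δ * X) ^ (1 / 2 : ℝ)) (X ^ (1 / 2 : ℝ))))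
    (hν : ν = volume.restrict (Set.Ioc ((δ * X) ^ (1 / k)) (X ^ (1 / k)))) :
    (∫ α : ℝ, T 2 δ X (l1 * α) * T 2 δ X (l2 * α) * T 2 δ X (l3 * α) *
      T k δ X (l4 * α) * (Kf η α : ℂ) * e (-(ω * α))) =
    ((∫ q : (ℝ × ℝ) × ℝ, ∫ t : ℝ, triangle η
      (l1 * t ^ (2 : ℝ) + (l2 * q.1.1 ^ (2 : ℝ) + l3 * q.1.2 ^ (2 : ℝ) + l4 * q.2 ^ k - ω))
      ∂μ ∂((μ.prod μ).prod ν) : ℝ) : ℂ) := by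
  have : IsFiniteMeasure μ := by
    rw [hμ]
    infer_instance
  have : IsFiniteMeasure ν := by
    rw [hν]
    infer_instance
  set φ : ((ℝ × ℝ) × ℝ) × ℝ → ℝ := fun p => l1 * p.2 ^ (2 : ℝ) +
    (l2 * p.1.1.1 ^ (2 : ℝ) + l3 * p.1.1.2 ^ (2 : ℝ) + l4 * p.1.2 ^ k - ω) with hφ
  have hφm : Measurable φ := by fun_prop
  have h := integral_integral_e_mul_Kf (((μ.prod μ).prod ν).prod μ) hφm hη
  rw [integral_prod _ (integrable_triangle_comp _ hφm hη.le)] at h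
  rw [← h]
  congr 1
  ext α
  have hprod : ∫ p, e (α * φ p) ∂(((μ.prod μ).prod ν).prod μ) =
      T 2 δ X (l2 * α) * T 2 δ X (l3 * α) * T k δ X (l4 * α) * T 2 δ X (l1 * α) *
        e (-(ω * α)) := by
    simp_rw [T_eq_setIntegral two_pos hδ hδ1 hX, T_eq_setIntegral hk hδ hδ1 hX, ← hμ, ← hν]
    rw [← integral_prod_mul, ← integral_prod_mul, ← integral_prod_mul, ← integral_mul_const]
    congr 1
    ext p
    simp only [← e_add, hφ]
    congr 1
    ring
  rw [hprod]
  ring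

/-- If `w_i / X ∈ [u_i, u_i + ε]` for `i = 2, 3, 4`, then the solution `w` of
`l1 * w + l2 * w2 + l3 * w3 + l4 * w4 = ω` is close to `u1 * X`. -/
lemma abs_sub_solution_le {l1 l2 l3 l4 u1 u2 u3 u4 ε ω X w2 w3 w4 : ℝ} (h1 : l1 ≠ 0)
    (hu : l1 * u1 + l2 * u2 + l3 * u3 + l4 * u4 = 0) (hX : 0 < X)
    (hε : ε * (|l2| + |l3| + |l4|) ≤ u1 * |l1| / 4) (hω : |ω| ≤ u1 * |l1| / 4 * X)
    (hw2 : u2 * X ≤ w2 ∧ w2 ≤ (u2 + ε) * X) (hw3 : u3 * X ≤ w3 ∧ w3 ≤ (u3 + ε) * X)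
    (hw4 : u4 * X ≤ w4 ∧ w4 ≤ (u4 + ε) * X) :
    |(ω - l2 * w2 - l3 * w3 - l4 * w4) / l1 - u1 * X| ≤ u1 / 2 * X := by
  have hdiff (l u w : ℝ) (hw : u * X ≤ w ∧ w ≤ (u + ε) * X) :
      |l * (w - u * X)| ≤ |l| * (ε * X) := by
    rw [abs_mul, abs_of_nonneg (by linarith : 0 ≤ w - u * X)]
    exact mul_le_mul_of_nonneg_left (by linarith) (abs_nonneg l)
  have hsub : (ω - l2 * w2 - l3 * w3 - l4 * w4) / l1 - u1 * X =
      (ω - l2 * (w2 - u2 * X) - l3 * (w3 - u3 * X) - l4 * (w4 - u4 * X)) / l1 := by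
    rw [eq_div_iff h1, sub_mul, div_mul_cancel₀ _ h1]
    linear_combination -X * hu
  rw [hsub, abs_div, div_le_iff₀ (abs_pos.2 h1)]
  have a2 := abs_le.1 (hdiff l2 u2 w2 hw2)
  have a3 := abs_le.1 (hdiff l3 u3 w3 hw3)
  have a4 := abs_le.1 (hdiff l4 u4 w4 hw4)
  have aω := abs_le.1 hω
  have hεX := mul_le_mul_of_nonneg_right hε hX.le
  rw [abs_le]
  constructor <;> linarith [a2.1, a2.2, a3.1, a3.2, a4.1, a4.2, aω.1, aω.2]

theorem statement14 (k : ℝ) (hk : 1 < k) (l1 l2 l3 l4 : ℝ)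
    (h1 : l1 ≠ 0) (h2 : l2 ≠ 0) (h3 : l3 ≠ 0) (h4 : l4 ≠ 0)
    (hsign : ¬ ((0 < l1 ∧ 0 < l2 ∧ 0 < l3 ∧ 0 < l4) ∨ (l1 < 0 ∧ l2 < 0 ∧ l3 < 0 ∧ l4 < 0)))
    (ω : ℝ) :
    ∃ δ : ℝ, 0 < δ ∧ δ < 1 ∧ ∃ C > (0 : ℝ), ∃ X0 : ℝ, ∀ X ≥ X0,
      ∀ η : ℝ, 0 < η → η ≤ 1 →
      ∃ J : ℝ,
        (∫ α : ℝ, T 2 δ X (l1 * α) * T 2 δ X (l2 * α) * T 2 δ X (l3 * α) *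
          T k δ X (l4 * α) * (Kf η α : ℂ) * e (-(ω * α))) = (J : ℂ) ∧
        C * η ^ 2 * X ^ ((1 : ℝ) / 2 + 1 / k) ≤ J := by
  have hk0 : 0 < k := by linarith
  have hl1 : 0 < |l1| := abs_pos.2 h1
  have hl2 : 0 < |l2| := abs_pos.2 h2
  have hl3 := abs_nonneg l3
  have hl4 := abs_nonneg l4
  obtain ⟨u1, u2, u3, u4, ⟨hu1, hu1'⟩, ⟨hu2, hu2'⟩, ⟨hu3, hu3'⟩, ⟨hu4, hu4'⟩, hu⟩ :=
    exists_pos_linear_relation h1 h2 h3 h4 hsign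
  obtain ⟨ε, hε0, hε1, hε⟩ : ∃ ε : ℝ, 0 < ε ∧ ε ≤ 1 / 2 ∧
      ε * (|l2| + |l3| + |l4|) ≤ u1 * |l1| / 4 := by
    refine ⟨min (1 / 2) (u1 * |l1| / 4 / (|l2| + |l3| + |l4|)),
      lt_min (by norm_num) (by positivity), min_le_left _ _, ?_⟩
    rw [← le_div_iff₀ (by positivity)]
    exact min_le_right _ _
  obtain ⟨δ, hδ0, hδ1, hδ2, hδ3, hδ4⟩ :
      ∃ δ : ℝ, 0 < δ ∧ δ ≤ u1 / 2 ∧ δ ≤ u2 ∧ δ ≤ u3 ∧ δ ≤ u4 :=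
    ⟨min (u1 / 2) (min u2 (min u3 u4)), by positivity, by simp, by simp, by simp, by simp⟩
  have hgap (κ u : ℝ) (hκ : 0 < κ) (hu : 0 < u) : 0 < (u + ε) ^ (1 / κ) - u ^ (1 / κ) :=
    sub_pos.2 (Real.rpow_lt_rpow hu.le (by linarith) (by positivity))
  have hA2 := hgap 2 u2 two_pos hu2
  have hA3 := hgap 2 u3 two_pos hu3
  have hA4 := hgap k u4 hk0 hu4
  refine ⟨δ, hδ0, by linarith, 1 / (20 * (1 + |l1|)) * (((u2 + ε) ^ (1 / 2 : ℝ) - u2 ^ (1 / 2 : ℝ)) *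
    ((u3 + ε) ^ (1 / 2 : ℝ) - u3 ^ (1 / 2 : ℝ)) * ((u4 + ε) ^ (1 / k) - u4 ^ (1 / k))),
    by positivity, max 1 (|ω| / (u1 * |l1| / 4)), fun X hX η hη hη1 => ?_⟩
  have hX1 : 1 ≤ X := (le_max_left _ _).trans hX
  have hX0 : 0 < X := by linarith
  have hω : |ω| ≤ u1 * |l1| / 4 * X := by
    rw [← div_le_iff₀' (by positivity)]
    exact (le_max_right _ _).trans hX
  set μ := volume.restrict (Set.Ioc ((δ * X) ^ (1 / 2 : ℝ)) (X ^ (1 / 2 : ℝ))) with hμ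
  set ν := volume.restrict (Set.Ioc ((δ * X) ^ (1 / k)) (X ^ (1 / k))) with hν
  refine ⟨_, integral_T_mul_eq hk0 hδ0.le (by linarith) hX0.le hη l1 l2 l3 l4 ω μ ν hμ hν, ?_⟩
  have hmeas : Measurable fun p : ((ℝ × ℝ) × ℝ) × ℝ => l1 * p.2 ^ (2 : ℝ) +
      (l2 * p.1.1.1 ^ (2 : ℝ) + l3 * p.1.1.2 ^ (2 : ℝ) + l4 * p.1.2 ^ k - ω) := by fun_prop
  have hint := (integrable_triangle_comp (((μ.prod μ).prod ν).prod μ) hmeas hη.le).integral_prod_left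
  have hbox : ∀ q ∈ (Set.Ioc ((u2 * X) ^ (1 / 2 : ℝ)) (((u2 + ε) * X) ^ (1 / 2 : ℝ)) ×ˢ
      Set.Ioc ((u3 * X) ^ (1 / 2 : ℝ)) (((u3 + ε) * X) ^ (1 / 2 : ℝ))) ×ˢ
      Set.Ioc ((u4 * X) ^ (1 / k)) (((u4 + ε) * X) ^ (1 / k)),
      η / 2 * (η / (10 * (1 + |l1|)) * X ^ (-(1 / 2) : ℝ)) ≤ ∫ t : ℝ, triangle η
        (l1 * t ^ (2 : ℝ) + (l2 * q.1.1 ^ (2 : ℝ) + l3 * q.1.2 ^ (2 : ℝ) + l4 * q.2 ^ k - ω))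
        ∂μ := by
    rintro q ⟨⟨hq2, hq3⟩, hq4⟩
    have hV := abs_le.1 (abs_sub_solution_le h1 hu hX0 hε hω
      (rpow_mem_of_mem_Ioc two_pos hu2.le (by positivity) hX0.le hq2)
      (rpow_mem_of_mem_Ioc two_pos hu3.le (by positivity) hX0.le hq3)
      (rpow_mem_of_mem_Ioc hk0 hu4.le (by positivity) hX0.le hq4))
    refine (le_integral_triangle_quadratic (l := l1) hδ0.le hX1 hη hη1
      (by nlinarith [hV.1]) (by nlinarith [hV.2])).trans_eq ?_
    congr 1
    ext t
    congr 1
    rw [mul_sub, mul_div_cancel₀ _ h1]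
    ring
  have h := mul_measureReal_le_integral
    ((measurableSet_Ioc.prod measurableSet_Ioc).prod measurableSet_Ioc) hint
    (fun _ => integral_nonneg fun _ => triangle_nonneg _ _) hbox
  rw [measureReal_prod_prod, measureReal_prod_prod,
    measureReal_restrict_Ioc_rpow two_pos hδ0.le hδ2 (by linarith) (by linarith) hX0.le,
    measureReal_restrict_Ioc_rpow two_pos hδ0.le hδ3 (by linarith) (by linarith) hX0.le,
    measureReal_restrict_Ioc_rpow hk0 hδ0.le hδ4 (by linarith) (by linarith) hX0.le] at h
  refine le_trans (le_of_eq ?_) h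
  have hpow : X ^ (-(1 / 2) : ℝ) * X ^ (1 / 2 : ℝ) = 1 := by
    rw [← Real.rpow_add hX0]
    norm_num
  rw [Real.rpow_add hX0]
  field_simp
  linear_combination -20 * hpow

end
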